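/- arXiv:1701.03746 — 7 statements merged into one kernel-verified Lean document; each statement's English description precedes it below -/
import Mathlib

section
/- Let X be a set and let K : X × X → [0,∞] be a kernel satisfying: (K1) K(x,y) = K(y,x) for all x,y ∈ X; (K2) K(x,y) > 0 for all x,y ∈ X; (K3) K(x,y) = +∞ if and only if x = y; (K4) there exists a function ν : (0,∞) → (0,∞) that is continuous, concave, strictly increasing, surjective onto (0,∞), and satisfies ν(λ) < λ for every λ > 0, such that for every λ > 0 and all x,y,z ∈ X, if K(x,y) > λ and K(y,z) > λ then K(x,z) > ν(λ). Then there exist a continuous decreasing function φ : (0,∞) → (0,∞) and a quasi-metric d on X such that K(x,y) = φ(d(x,y)) for all x ≠ y. Moreover d(x,y) = h(x,y)·ρ(x,y) where ρ is a metric on X and h is a symmetric function on X × X for which there exist constants 0 < c₁ < c₂ < ∞ with c₁ ≤ h(x,y) ≤ c₂ for every x,y ∈ X. -/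
theorem aux_iter (ν : ℝ → ℝ) (hm : StrictMonoOn ν (Set.Ioi 0))
    (hM : Set.MapsTo ν (Set.Ioi 0) (Set.Ioi 0)) (n : ℕ) :
    StrictMonoOn (ν^[n]) (Set.Ioi 0) ∧ Set.MapsTo (ν^[n]) (Set.Ioi 0) (Set.Ioi 0) := by
  refine ⟨?_, hM.iterate n⟩
  induction n with
  | zero => exact strictMonoOn_id
  | succ n ih =>
    rw [Function.iterate_succ]
    exact ih.comp hm hM

theorem aux_low (ν : ℝ → ℝ) (hconc : ConcaveOn ℝ (Set.Ioi 0) ν)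
    (hm : StrictMonoOn ν (Set.Ioi 0))
    (hM : Set.MapsTo ν (Set.Ioi 0) (Set.Ioi 0)) (hlt : ∀ l : ℝ, 0 < l → ν l < l) :
    ∃ C : ℝ, 0 < C ∧ C < 1 ∧ ∀ l, 0 < l → ∀ n : ℕ, C ^ n * min l 1 ≤ ν^[n] l := by
  have h1 : 0 < ν 1 := hM (Set.mem_Ioi.2 one_pos)
  have h1' : ν 1 < 1 := hlt 1 one_pos
  have key : ∀ l, 0 < l → ν 1 / 2 * min l 1 ≤ ν l := by
    intro l hl
    rcases le_total 1 l with h | h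
    · rw [min_eq_right h]
      have := hm.monotoneOn (Set.mem_Ioi.2 one_pos) (Set.mem_Ioi.2 hl) h
      linarith
    · rw [min_eq_left h]
      have hd : 0 < 1 - l / 2 := by linarith
      have hcc := hconc.2
      have hc := @hcc (l / 2) (Set.mem_Ioi.2 (by linarith)) 1
        (Set.mem_Ioi.2 one_pos)
        ( 1 - (l / 2) / (1 - l / 2)) ((l / 2) / (1 - l / 2))
        (by rw [sub_nonneg, div_le_one hd]; linarith) (by positivity) (by ring)
      have he : (1 - (l / 2) / (1 - l / 2)) • (l / 2) + ((l / 2) / (1 - l / 2)) • (1:ℝ) = l := by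
        simp only [smul_eq_mul]
        have ht : (l / 2) / (1 - l / 2) * (1 - l / 2) = l / 2 := div_mul_cancel₀ _ hd.ne'
        linear_combination ht
      rw [he] at hc
      simp only [smul_eq_mul] at hc
      have h2 : 0 ≤ (1 - (l / 2) / (1 - l / 2)) * ν (l / 2) := by
        apply mul_nonneg
        · rw [sub_nonneg, div_le_one hd]; linarith
        · exact (hM (Set.mem_Ioi.2 (by linarith : 0 < l / 2))).le
      have h3 : l / 2 ≤ (l / 2) / (1 - l / 2) := by
        rw [le_div_iff₀ hd]; nlinarith
      nlinarith
  refine ⟨ν 1 / 2, by linarith, by linarith, fun l hl n => ?_⟩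
  induction n with
  | zero => simp
  | succ n ih =>
    rw [Function.iterate_succ_apply']
    have hp : 0 < ν^[n] l := (aux_iter ν hm hM n).2 hl
    refine le_trans ?_ (key _ hp)
    rw [pow_succ', mul_assoc]
    gcongr
    refine le_min ih ?_
    have : (ν 1 / 2) ^ n ≤ 1 := pow_le_one₀ (by linarith) (by linarith)
    have h4 : min l 1 ≤ 1 := min_le_right _ _
    have h5 : 0 < min l 1 := lt_min hl one_pos
    nlinarith

theorem aux_g (ν : ℝ → ℝ) (hcont : ContinuousOn ν (Set.Ioi 0))
    (hconc : ConcaveOn ℝ (Set.Ioi 0) ν)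
    (hm : StrictMonoOn ν (Set.Ioi 0))
    (hM : Set.MapsTo ν (Set.Ioi 0) (Set.Ioi 0))
    (hS : Set.SurjOn ν (Set.Ioi 0) (Set.Ioi 0)) (hlt : ∀ l : ℝ, 0 < l → ν l < l) :
    ∃ g : ℝ → ℝ, ContinuousOn g (Set.Ioi 0) ∧ StrictAntiOn g (Set.Ioi 0) ∧
      Set.MapsTo g (Set.Ioi 0) (Set.Ioi 0) ∧ Set.SurjOn g (Set.Ioi 0) (Set.Ioi 0) ∧
      ∀ l, 0 < l → g (ν l) ≤ √2 * g l := by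
  obtain ⟨C, hC0, hC1, hC⟩ := aux_low ν hconc hm hM hlt
  set s := Real.logb C (4/5) with hs
  have hCs : C ^ s = 4 / 5 := Real.rpow_logb hC0 hC1.ne (by norm_num)
  have hs0 : 0 < s := Real.logb_pos_of_base_lt_one hC0 hC1 (by norm_num) (by norm_num)
  have h2 : (0:ℝ) < √2 := by positivity
  have h2' : (7/5:ℝ) < √2 := Real.lt_sqrt_of_sq_lt (by norm_num)
  set q : ℝ := (√2)⁻¹ with hq
  have hq0 : 0 < q := by positivity
  have hq1 : q * (5/4) < 1 := by
    rw [hq, inv_mul_lt_iff₀ h2]; linarith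
  set F : ℕ → ℝ → ℝ := fun n l => q ^ n * (ν^[n] l) ^ (-s) with hF
  have hpos : ∀ n l, 0 < l → 0 < ν^[n] l := fun n l hl => (aux_iter ν hm hM n).2 hl
  have hFpos : ∀ n l, 0 < l → 0 < F n l := fun n l hl =>
    mul_pos (pow_pos hq0 n) (Real.rpow_pos_of_pos (hpos n l hl) _)
  have hFanti : ∀ n l l', 0 < l → l < l' → F n l' < F n l := by
    intro n l l' hl hll
    apply mul_lt_mul_of_pos_left _ (pow_pos hq0 n)
    exact Real.rpow_lt_rpow_of_neg (hpos n l hl)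
      ((aux_iter ν hm hM n).1 hl (hl.trans hll) hll) (by linarith)
  have hFb : ∀ n l, 0 < l → F n l ≤ (q * (5/4)) ^ n * (min l 1) ^ (-s) := by
    intro n l hl
    have h5 : 0 < min l 1 := lt_min hl one_pos
    have : (ν^[n] l) ^ (-s) ≤ (C ^ n * min l 1) ^ (-s) :=
      Real.rpow_le_rpow_of_nonpos (by positivity) (hC l hl n) (by linarith)
    have e : (C ^ n * min l 1) ^ (-s) = (5/4) ^ n * (min l 1) ^ (-s) := by
      rw [Real.mul_rpow (by positivity) h5.le]
      congr 1
      rw [← Real.rpow_natCast, ← Real.rpow_mul hC0.le, mul_comm, Real.rpow_mul hC0.le,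
        Real.rpow_neg hC0.le, hCs, Real.rpow_natCast]
      norm_num
    rw [e] at this
    calc F n l ≤ q ^ n * ((5/4) ^ n * (min l 1) ^ (-s)) := by
          apply mul_le_mul_of_nonneg_left this (by positivity)
      _ = _ := by rw [mul_pow]; ring
  have hsumb : ∀ M : ℝ, Summable (fun n : ℕ => (q * (5/4)) ^ n * M) := fun M =>
    (summable_geometric_of_lt_one (by positivity) hq1).mul_right M
  have hsum : ∀ l, 0 < l → Summable (fun n => F n l) := fun l hl =>
    Summable.of_nonneg_of_le (fun n => (hFpos n l hl).le) (fun n => hFb n l hl) (hsumb _)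
  have hiterc : ∀ n, ContinuousOn (ν^[n]) (Set.Ioi 0) := fun n => hcont.iterate hM n
  have hFc : ∀ n, ContinuousOn (F n) (Set.Ioi 0) := fun n =>
    continuousOn_const.mul ((hiterc n).rpow_const fun x hx => Or.inl (hpos n x hx).ne')
  set g : ℝ → ℝ := fun l => ∑' n, F n l with hg
  have hgpos : ∀ l, 0 < l → 0 < g l := fun l hl =>
    (hsum l hl).tsum_pos (fun n => (hFpos n l hl).le) 0 (hFpos 0 l hl)
  have hgc : ContinuousOn g (Set.Ioi 0) := by
    intro l hl
    have hl : 0 < l := hl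
    apply ContinuousAt.continuousWithinAt
    have : ContinuousOn g (Set.Ioi (l/2)) := by
      apply continuousOn_tsum (u := fun n : ℕ => (q * (5/4)) ^ n * (min (l/2) 1) ^ (-s))
      · exact fun n => (hFc n).mono (Set.Ioi_subset_Ioi (by linarith))
      · exact hsumb _
      · intro n x hx
        have hx : l / 2 < x := hx
        rw [Real.norm_of_nonneg (hFpos n x (by linarith)).le]
        exact (hFanti n (l/2) x (by linarith) hx).le.trans (hFb n _ (by linarith))
    exact this.continuousAt (Ioi_mem_nhds (by linarith))
  have hνtop : Filter.Tendsto ν Filter.atTop Filter.atTop := by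
    rw [Filter.tendsto_atTop]
    intro b
    obtain ⟨p, hp, hpb⟩ := hS (Set.mem_Ioi.2 (lt_max_of_lt_right one_pos : (0:ℝ) < max b 1))
    filter_upwards [Filter.eventually_ge_atTop p] with x hx
    have := hm.monotoneOn hp (lt_of_lt_of_le hp hx) hx
    exact (le_max_left b 1).trans (hpb ▸ this)
  have hg0 : Filter.Tendsto g Filter.atTop (nhds 0) := by
    have : Filter.Tendsto g Filter.atTop (nhds (∑' n : ℕ, (0:ℝ))) := by
      apply tendsto_tsum_of_dominated_convergence
        (bound := fun n : ℕ => (q * (5/4)) ^ n * (min (1:ℝ) 1) ^ (-s)) (hsumb _)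
      · intro n
        have := ((tendsto_rpow_neg_atTop hs0).comp (hνtop.iterate n)).const_mul (q ^ n)
        simpa [hF, Function.comp_def] using this
      · filter_upwards [Filter.eventually_gt_atTop 1] with x hx n
        rw [Real.norm_of_nonneg (hFpos n x (by linarith)).le]
        exact (hFanti n 1 x one_pos hx).le.trans (hFb n _ one_pos)
    simpa using this
  have hgu : ∀ l, 0 < l → l ^ (-s) ≤ g l := by
    intro l hl
    have := (hsum l hl).le_tsum 0 (fun n _ => (hFpos n l hl).le)
    simpa [hF] using this
  refine ⟨g, hgc, ?_, fun l hl => hgpos l hl, ?_, ?_⟩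
  · intro l hl l' hl' hll
    exact Summable.tsum_lt_tsum (i := 0) (fun n => (hFanti n l l' hl hll).le)
      (hFanti 0 l l' hl hll) (hsum l' hl') (hsum l hl)
  · intro y hy
    have hy : 0 < y := hy
    obtain ⟨p, hp1, hp2⟩ := ((hg0.eventually (gt_mem_nhds hy)).and
      (Filter.eventually_gt_atTop 0)).exists
    have hr : 0 < y ^ (-s⁻¹) := Real.rpow_pos_of_pos hy _
    have h3 := hgu _ hr
    rw [← Real.rpow_mul hy.le, neg_mul_neg, inv_mul_cancel₀ hs0.ne', Real.rpow_one] at h3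
    exact isPreconnected_Ioi.intermediate_value hp2 hr hgc ⟨hp1.le, h3⟩
  · intro l hl
    have e : g l = F 0 l + ∑' n, F (n+1) l := (hsum l hl).tsum_eq_zero_add
    have e2 : ∀ n, F (n+1) l = q * F n (ν l) := by
      intro n
      simp only [hF, Function.iterate_succ_apply, pow_succ]
      ring
    simp only [e2] at e
    rw [tsum_mul_left] at e
    have h6 := hFpos 0 l hl
    have h7 : q * g (ν l) ≤ g l := by
      have : g (ν l) = ∑' n, F n (ν l) := rfl
      rw [e, this]; linarith
    rwa [hq, inv_mul_le_iff₀ h2] at h7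

/-- A symmetric, positive kernel `K : X × X → [0,∞]` that is infinite exactly on
the diagonal and satisfies the quantitative transitivity property (K4) admits a Newtonian
representation `K(x,y) = φ(d(x,y))` with `φ` continuous and decreasing on `(0,∞)` and `d` a
quasi-metric of the form `d = h·ρ` with `ρ` a metric and `h` symmetric, bounded between two
positive constants. -/
theorem newtonian_structure_of_affinity_kernels
    {X : Type*} (K : X → X → ENNReal)
    (hK1 : ∀ x y, K x y = K y x)
    (hK2 : ∀ x y, 0 < K x y)
    (hK3 : ∀ x y, K x y = ⊤ ↔ x = y)
    (hK4 : ∃ ν : ℝ → ℝ,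
      ContinuousOn ν (Set.Ioi 0) ∧
      ConcaveOn ℝ (Set.Ioi 0) ν ∧
      StrictMonoOn ν (Set.Ioi 0) ∧
      Set.MapsTo ν (Set.Ioi 0) (Set.Ioi 0) ∧
      Set.SurjOn ν (Set.Ioi 0) (Set.Ioi 0) ∧
      (∀ l : ℝ, 0 < l → ν l < l) ∧
      (∀ l : ℝ, 0 < l → ∀ x y z : X,
        ENNReal.ofReal l < K x y → ENNReal.ofReal l < K y z →
          ENNReal.ofReal (ν l) < K x z)) :
    ∃ (φ : ℝ → ℝ) (d : X → X → ℝ),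
      -- φ is continuous, decreasing and positive on (0,∞)
      ContinuousOn φ (Set.Ioi 0) ∧
      StrictAntiOn φ (Set.Ioi 0) ∧
      (∀ r : ℝ, 0 < r → 0 < φ r) ∧
      -- d is a quasi-metric on X
      (∀ x y, 0 ≤ d x y) ∧
      (∀ x y, d x y = d y x) ∧
      (∀ x y, d x y = 0 ↔ x = y) ∧
      (∃ τ : ℝ, 1 ≤ τ ∧ ∀ x y z, d x z ≤ τ * (d x y + d y z)) ∧
      -- Newtonian representation off the diagonal
      (∀ x y, x ≠ y → K x y = ENNReal.ofReal (φ (d x y))) ∧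
      -- d = h·ρ with ρ a metric and h symmetric, bounded between positive constants
      (∃ (ρ : X → X → ℝ) (h : X → X → ℝ) (c₁ c₂ : ℝ),
        0 < c₁ ∧ c₁ < c₂ ∧
        (∀ x y, 0 ≤ ρ x y) ∧
        (∀ x y, ρ x y = ρ y x) ∧
        (∀ x y, ρ x y = 0 ↔ x = y) ∧
        (∀ x y z, ρ x z ≤ ρ x y + ρ y z) ∧
        (∀ x y, h x y = h y x) ∧
        (∀ x y, c₁ ≤ h x y ∧ h x y ≤ c₂) ∧
        (∀ x y, d x y = h x y * ρ x y)) := by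
  classical
  obtain ⟨ν, hcont, hconc, hm, hM, hS, hlt, hν⟩ := hK4
  obtain ⟨g, hgc, hga, hgM, hgS, hgν⟩ := aux_g ν hcont hconc hm hM hS hlt
  set φ : ℝ → ℝ := Function.invFunOn g (Set.Ioi 0) with hφ
  have hφpos : ∀ r, 0 < r → 0 < φ r := fun r hr => Function.invFunOn_mem (hgS hr)
  have hgφ : ∀ r, 0 < r → g (φ r) = r := fun r hr => Function.invFunOn_eq (hgS hr)
  have hφg : ∀ l, 0 < l → φ (g l) = l := fun l hl =>
    hga.injOn (hφpos _ (hgM hl)) hl (hgφ _ (hgM hl))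
  have hφa : StrictAntiOn φ (Set.Ioi 0) := by
    intro r hr r' hr' hrr
    by_contra! h
    have := hga.antitoneOn (hφpos r hr) (hφpos r' hr') h
    rw [hgφ r hr, hgφ r' hr'] at this
    linarith
  have hφc : ContinuousOn φ (Set.Ioi 0) := by
    intro r hr
    apply ContinuousAt.continuousWithinAt
    have hmono : StrictMonoOn (fun x => - φ x) (Set.Ioi 0) := fun x hx y hy hxy =>
      neg_lt_neg (hφa hx hy hxy)
    have := hmono.continuousAt_of_image_mem_nhds (Ioi_mem_nhds hr) (by
      apply Filter.mem_of_superset (Iio_mem_nhds (neg_lt_zero.2 (hφpos r hr)))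
      intro t ht
      have ht : 0 < -t := by simpa using ht
      exact ⟨g (-t), hgM ht, by simp [hφg _ ht]⟩)
    have h' := this.neg
    have e : (-fun x => -φ x) = φ := by funext x; simp
    rwa [e] at h'
  have hkpos : ∀ x y, x ≠ y → 0 < (K x y).toReal := fun x y h =>
    ENNReal.toReal_pos (hK2 x y).ne' (fun h' => h ((hK3 x y).1 h'))
  set d : X → X → ℝ := fun x y => if x = y then 0 else g (K x y).toReal with hd
  have hdself : ∀ x, d x x = 0 := fun x => by simp [hd]
  have hdne : ∀ x y, x ≠ y → d x y = g (K x y).toReal := fun x y h => by simp [hd, h]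
  have hdpos : ∀ x y, x ≠ y → 0 < d x y := fun x y h => by
    rw [hdne x y h]; exact hgM (hkpos x y h)
  have hd0 : ∀ x y, 0 ≤ d x y := fun x y => by
    by_cases h : x = y
    · rw [h, hdself]
    · exact (hdpos x y h).le
  have hdc : ∀ x y, d x y = d y x := fun x y => by
    simp only [hd, hK1 x y, eq_comm]
  have h2' : (7/5:ℝ) < √2 := Real.lt_sqrt_of_sq_lt (by norm_num)
  have h22 : √2 * √2 = (2:ℝ) := Real.mul_self_sqrt (by norm_num)
  have hquasi : ∀ x y z, d x z ≤ √2 * max (d x y) (d y z) := by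
    intro x y z
    by_cases hxy : x = y
    · subst hxy
      rw [hdself, max_eq_right (hd0 _ _)]
      nlinarith [hd0 x z]
    by_cases hyz : y = z
    · subst hyz
      rw [hdself, max_eq_left (hd0 _ _)]
      nlinarith [hd0 x y]
    by_cases hxz : x = z
    · rw [hxz, hdself]
      exact mul_nonneg (by linarith) (le_max_of_le_left (hd0 _ _))
    set m := min (K x y).toReal (K y z).toReal with hmdef
    have hm0 : 0 < m := lt_min (hkpos x y hxy) (hkpos y z hyz)
    have hfin : ∀ x y, x ≠ y → K x y ≠ ⊤ := fun x y h h' => h ((hK3 x y).1 h')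
    have hle : ν m ≤ (K x z).toReal := by
      have hca : ContinuousAt ν m := hcont.continuousAt (Ioi_mem_nhds hm0)
      have ht : Filter.Tendsto ν (nhdsWithin m (Set.Iio m)) (nhds (ν m)) :=
        hca.tendsto.mono_left nhdsWithin_le_nhds
      refine le_of_tendsto ht ?_
      filter_upwards [Ioo_mem_nhdsLT hm0] with l hl
      have h1 : ENNReal.ofReal l < K x y :=
        (ENNReal.ofReal_lt_iff_lt_toReal hl.1.le (hfin x y hxy)).2
          (hl.2.trans_le (min_le_left _ _))
      have h2 : ENNReal.ofReal l < K y z :=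
        (ENNReal.ofReal_lt_iff_lt_toReal hl.1.le (hfin y z hyz)).2
          (hl.2.trans_le (min_le_right _ _))
      have h3 := hν l hl.1 x y z h1 h2
      exact ((ENNReal.ofReal_lt_iff_lt_toReal (le_of_lt (hM hl.1)) (hfin x z hxz)).1 h3).le
    have h4 : d x z ≤ √2 * g m := by
      rw [hdne x z hxz]
      exact (hga.antitoneOn (hM hm0) (hkpos x z hxz) hle).trans (hgν m hm0)
    refine h4.trans (mul_le_mul_of_nonneg_left ?_ (by linarith))
    rw [hdne x y hxy, hdne y z hyz]
    rcases min_choice (K x y).toReal (K y z).toReal with h | h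
    · rw [hmdef, h]; exact le_max_left _ _
    · rw [hmdef, h]; exact le_max_right _ _
  -- Frink metrization
  let D : X → X → NNReal := fun x y => ⟨d x y, hd0 x y⟩
  have hDself : ∀ x, D x x = 0 := fun x => NNReal.eq (hdself x)
  have hDc : ∀ x y, D x y = D y x := fun x y => NNReal.eq (hdc x y)
  have hD4 : ∀ x₁ x₂ x₃ x₄, D x₁ x₄ ≤ 2 * max (D x₁ x₂) (max (D x₂ x₃) (D x₃ x₄)) := by
    intro x₁ x₂ x₃ x₄
    rw [← NNReal.coe_le_coe]
    push_cast
    change d x₁ x₄ ≤ 2 * max (d x₁ x₂) (max (d x₂ x₃) (d x₃ x₄))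
    set M := max (d x₁ x₂) (max (d x₂ x₃) (d x₃ x₄)) with hMd
    have hM0 : 0 ≤ M := le_max_of_le_left (hd0 _ _)
    have a1 : d x₁ x₂ ≤ M := le_max_left _ _
    have a2 : d x₂ x₃ ≤ M := (le_max_left _ _).trans (le_max_right _ _)
    have a3 : d x₃ x₄ ≤ M := (le_max_right _ _).trans (le_max_right _ _)
    have b1 : d x₁ x₃ ≤ √2 * M := (hquasi x₁ x₂ x₃).trans
      (mul_le_mul_of_nonneg_left (max_le a1 a2) (by linarith))
    have b2 : d x₁ x₄ ≤ √2 * (√2 * M) := (hquasi x₁ x₃ x₄).trans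
      (mul_le_mul_of_nonneg_left (max_le b1 (by nlinarith)) (by linarith))
    rwa [← mul_assoc, h22] at b2
  let P := PseudoMetricSpace.ofPreNNDist D hDself hDc
  have hρle : ∀ x y, dist x y ≤ d x y := fun x y =>
    PseudoMetricSpace.dist_ofPreNNDist_le D hDself hDc x y
  have hleρ : ∀ x y, d x y ≤ 2 * dist x y := fun x y =>
    PseudoMetricSpace.le_two_mul_dist_ofPreNNDist D hDself hDc hD4 x y
  have hρpos : ∀ x y : X, x ≠ y → 0 < dist x y := fun x y h => by
    have := hdpos x y h
    have := hleρ x y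
    linarith
  refine ⟨φ, d, hφc, hφa, hφpos, hd0, hdc, ?_, ⟨2, by norm_num, ?_⟩, ?_, ?_⟩
  · intro x y
    refine ⟨fun h => ?_, fun h => by rw [h, hdself]⟩
    by_contra hne
    exact (hdpos x y hne).ne' h
  · intro x y z
    have := dist_triangle x y z
    linarith [hleρ x z, hρle x y, hρle y z]
  · intro x y hxy
    rw [hdne x y hxy, hφg _ (hkpos x y hxy), ENNReal.ofReal_toReal]
    exact fun h' => hxy ((hK3 x y).1 h')
  · refine ⟨fun x y => dist x y, fun x y => if x = y then 1 else d x y / dist x y, 1, 2,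
      one_pos, by norm_num, fun x y => dist_nonneg, dist_comm, ?_, dist_triangle, ?_, ?_, ?_⟩
    · intro x y
      refine ⟨fun h => ?_, fun h => by simp [h]⟩
      by_contra hne
      exact (hρpos x y hne).ne' h
    · intro x y
      simp only [hdc x y, dist_comm x y, eq_comm]
    · intro x y
      by_cases h : x = y
      · simp [h]
      · simp only [h, if_false]
        rw [le_div_iff₀ (hρpos x y h), div_le_iff₀ (hρpos x y h), one_mul]
        exact ⟨hρle x y, hleρ x y⟩
    · intro x y
      by_cases h : x = y
      · simp [h, hdself]
      · simp only [h, if_false]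
        rw [div_mul_cancel₀ _ (hρpos x y h).ne']
end

section
/- Let X be a set and let K : X × X → [0,∞] be a kernel satisfying: (K1) K(x,y) = K(y,x) for all x,y ∈ X; (K2) K(x,y) > 0 for all x,y ∈ X; (K3) K(x,y) = +∞ if and only if x = y; (K4) there exists a function ν : (0,∞) → (0,∞) that is continuous, concave, strictly increasing, surjective onto (0,∞), and satisfies ν(λ) < λ for every λ > 0, such that for every λ > 0 and all x,y,z ∈ X, if K(x,y) > λ and K(y,z) > λ then K(x,z) > ν(λ). Then there exist a metric ρ on X, a real number β ≥ 1, a function h : X × X → ℝ with 2^(−1/β) ≤ h(x,y) ≤ 4 for all x,y ∈ X, and a continuous decreasing function φ : (0,∞) → (0,∞) with φ(r) → +∞ as r → 0⁺ and φ(r) → 0 as r → ∞, such that K(x,y) = φ(h(x,y)·ρ(x,y)) for all x ≠ y. -/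
/-- The profile as a function on the line. -/
theorem exists_profile_line (E : Set.Ioi (0:ℝ) ≃o Set.Ioi (0:ℝ)) (hE : ∀ l, E l < l) :
    ∃ f : ℝ → Set.Ioi (0:ℝ), StrictAnti f ∧ Function.Surjective f ∧ ∀ s, f (s + 1) = E (f s) := by
  let o : Set.Ioi (0:ℝ) := ⟨1, by simp⟩
  let a : ℤ → Set.Ioi (0:ℝ) := fun n => (E ^ n) o
  have ha1 : ∀ n, a (n + 1) = E (a n) := by
    intro n
    change (E ^ (n + 1)) o = E ((E ^ n) o)
    rw [add_comm, zpow_one_add]; rfl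
  have ha : StrictAnti a := strictAnti_int_of_succ_lt (fun n => by rw [ha1]; exact hE _)
  have hlow : ∀ y, ∃ n, a n < y := by
    intro y
    by_contra! hcon
    have hbdd : BddBelow (Set.range fun n => (a n : ℝ)) := ⟨0, by rintro _ ⟨n, rfl⟩; exact (a n).2.le⟩
    have hy : (y : ℝ) ≤ sInf (Set.range fun n => (a n : ℝ)) :=
      le_csInf (Set.range_nonempty _) (by rintro _ ⟨n, rfl⟩; exact hcon n)
    let L : Set.Ioi (0:ℝ) := ⟨sInf (Set.range fun n => (a n : ℝ)), lt_of_lt_of_le y.2 hy⟩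
    have hL : L < E.symm L := by
      have := hE (E.symm L); simpa using this
    obtain ⟨_, ⟨n, rfl⟩, hn⟩ := exists_lt_of_csInf_lt (Set.range_nonempty _)
      (show sInf (Set.range fun n => (a n : ℝ)) < (E.symm L : ℝ) from hL)
    have h2 : a (n + 1) < L := by
      rw [ha1, ← E.lt_symm_apply]; exact hn
    exact absurd (csInf_le hbdd ⟨n + 1, rfl⟩) (not_le.2 h2)
  have hhigh : ∀ y, ∃ n, y ≤ a n := by
    intro y
    by_contra! hcon
    have hbdd : BddAbove (Set.range fun n => (a n : ℝ)) :=
      ⟨y, by rintro _ ⟨n, rfl⟩; exact (hcon n).le⟩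
    have h0 : (a 0 : ℝ) ≤ sSup (Set.range fun n => (a n : ℝ)) := le_csSup hbdd ⟨0, rfl⟩
    let L : Set.Ioi (0:ℝ) := ⟨sSup (Set.range fun n => (a n : ℝ)), lt_of_lt_of_le (a 0).2 h0⟩
    obtain ⟨_, ⟨n, rfl⟩, hn⟩ := exists_lt_of_lt_csSup (Set.range_nonempty _)
      (show (E L : ℝ) < sSup (Set.range fun n => (a n : ℝ)) from hE L)
    have h2 : L < a (n - 1) := by
      rw [← E.lt_iff_lt, ← ha1, sub_add_cancel]; exact hn
    exact absurd (le_csSup hbdd ⟨n - 1, rfl⟩) (not_le.2 h2)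
  -- interpolation on the fundamental interval
  let c : ℝ := (E o : ℝ)
  have hc0 : 0 < c := (E o).2
  have hc1 : c < 1 := hE o
  let g : ℝ → Set.Ioi (0:ℝ) := fun s =>
    ⟨1 - (1 - c) * Int.fract s, by
      have h1 := Int.fract_nonneg s
      have h2 := (Int.fract_lt_one s).le
      simp only [Set.mem_Ioi]; nlinarith⟩
  have hgo : ∀ s, g s ≤ o := by
    intro s
    change 1 - (1 - c) * Int.fract s ≤ 1
    have h1 := Int.fract_nonneg s
    nlinarith
  have hgc : ∀ s, E o < g s := by
    intro s
    change c < 1 - (1 - c) * Int.fract s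
    have h2 := (Int.fract_lt_one s)
    nlinarith
  refine ⟨fun s => (E ^ ⌊s⌋) (g s), ?_, ?_, ?_⟩
  · intro s t hst
    change (E ^ ⌊t⌋) (g t) < (E ^ ⌊s⌋) (g s)
    rcases (Int.floor_mono hst.le).eq_or_lt with h | h
    · rw [h]
      apply (E ^ ⌊t⌋).strictMono
      change 1 - (1 - c) * Int.fract t < 1 - (1 - c) * Int.fract s
      have : Int.fract s < Int.fract t := by
        rw [Int.fract, Int.fract, h]; linarith
      nlinarith
    · calc (E ^ ⌊t⌋) (g t) ≤ a ⌊t⌋ := (E ^ ⌊t⌋).monotone (hgo t)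
        _ ≤ a (⌊s⌋ + 1) := ha.antitone (by omega)
        _ = (E ^ ⌊s⌋) (E o) := by
          change (E ^ (⌊s⌋ + 1)) o = _
          rw [zpow_add_one]; rfl
        _ < _ := (E ^ ⌊s⌋).strictMono (hgc s)
  · intro y
    obtain ⟨n1, hn1⟩ := hlow y
    obtain ⟨n, hn, hmax⟩ := Int.exists_greatest_of_bdd (P := fun n => y ≤ a n)
      ⟨n1, fun z hz => by
        by_contra! hcon
        exact absurd (hz.trans (ha.antitone hcon.le)) (not_le.2 hn1)⟩ (hhigh y)
    have hn' : a (n + 1) < y := by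
      by_contra! hcon
      have := hmax _ hcon
      omega
    obtain ⟨z, rfl⟩ := (E ^ n).surjective y
    have hz1 : z ≤ o := (E ^ n).le_iff_le.1 hn
    have hz2 : E o < z := by
      apply (E ^ n).lt_iff_lt.1
      have h3 : a (n + 1) = (E ^ n) (E o) := by
        change (E ^ (n + 1)) o = _
        rw [zpow_add_one]; rfl
      rwa [h3] at hn'
    have hz1' : (z : ℝ) ≤ 1 := hz1
    have hz2' : c < (z : ℝ) := hz2
    have hd : 0 < 1 - c := by linarith
    have hu0 : 0 ≤ (1 - (z:ℝ)) / (1 - c) := div_nonneg (by linarith) hd.le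
    have hu1 : (1 - (z:ℝ)) / (1 - c) < 1 := by rw [div_lt_one hd]; linarith
    refine ⟨n + (1 - (z:ℝ)) / (1 - c), ?_⟩
    have hfr : Int.fract ((n:ℝ) + (1 - (z:ℝ)) / (1 - c)) = (1 - (z:ℝ)) / (1 - c) := by
      rw [Int.fract_intCast_add, Int.fract_eq_self.2 ⟨hu0, hu1⟩]
    have hfl : ⌊(n:ℝ) + (1 - (z:ℝ)) / (1 - c)⌋ = n := by
      rw [Int.floor_intCast_add, Int.floor_eq_zero_iff.2 ⟨hu0, hu1⟩, add_zero]
    have hg : g ((n:ℝ) + (1 - (z:ℝ)) / (1 - c)) = z := by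
      apply Subtype.ext
      change 1 - (1 - c) * Int.fract ((n:ℝ) + (1 - (z:ℝ)) / (1 - c)) = z
      rw [hfr]; field_simp; ring
    change (E ^ ⌊(n:ℝ) + (1 - (z:ℝ)) / (1 - c)⌋) (g ((n:ℝ) + (1 - (z:ℝ)) / (1 - c))) = _
    rw [hfl, hg]
  · intro s
    have hg : g (s + 1) = g s := by
      apply Subtype.ext
      change 1 - (1 - c) * Int.fract (s + 1) = 1 - (1 - c) * Int.fract s
      rw [Int.fract_add_one]
    change (E ^ ⌊s + 1⌋) (g (s + 1)) = E ((E ^ ⌊s⌋) (g s))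
    rw [hg, Int.floor_add_one, add_comm, zpow_one_add]; rfl

/-- The profile on the half line. -/
theorem exists_profile (E : Set.Ioi (0:ℝ) ≃o Set.Ioi (0:ℝ)) (hE : ∀ l, E l < l) :
    ∃ φ : ℝ → Set.Ioi (0:ℝ), StrictAntiOn φ (Set.Ioi 0) ∧
      (∀ y, ∃ t, 0 < t ∧ φ t = y) ∧
      (∀ t, 0 < t → φ (2 * t) = E (E (φ t))) ∧ ContinuousOn φ (Set.Ioi 0) := by
  obtain ⟨f, hf1, hf2, hf3⟩ := exists_profile_line E hE
  have hcont : Continuous f := by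
    have h1 : Monotone (fun s => f (-s)) := fun s t h => hf1.antitone (neg_le_neg h)
    have h2 : Function.Surjective (fun s => f (-s)) := hf2.comp neg_surjective
    have h3 := (h1.continuous_of_surjective h2).comp continuous_neg
    simpa [Function.comp_def] using h3
  refine ⟨fun t => f (2 * Real.logb 2 t), ?_, ?_, ?_, ?_⟩
  · intro s hs t ht hst
    apply hf1
    have := Real.logb_lt_logb (b := 2) (by norm_num) hs hst
    linarith
  · intro y
    obtain ⟨s, rfl⟩ := hf2 y
    refine ⟨(2:ℝ) ^ (s / 2), by positivity, ?_⟩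
    simp only
    rw [Real.logb_rpow (by norm_num) (by norm_num)]
    congr 1; ring
  · intro t ht
    simp only
    rw [← hf3, ← hf3, Real.logb_mul (by norm_num) ht.ne', Real.logb_self_eq_one (by norm_num)]
    congr 1; ring
  · apply hcont.comp_continuousOn
    apply ContinuousOn.const_mul
    unfold Real.logb
    exact (Real.continuousOn_log.mono (fun x hx => ne_of_gt hx)).div_const _

/-- Precise form of the Newtonian representation: under (K1)–(K4) there are a
metric `ρ`, an exponent `β ≥ 1`, a function `h` with `2^(-1/β) ≤ h ≤ 4`, and a continuous
decreasing profile `φ : (0,∞) → (0,∞)` with `φ(0⁺) = +∞` and `φ(∞) = 0`, such that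
`K(x,y) = φ(h(x,y)·ρ(x,y))` for all `x ≠ y`. -/
theorem newtonian_representation_with_metric
    {X : Type*} (K : X → X → ENNReal)
    (hK1 : ∀ x y, K x y = K y x)
    (hK2 : ∀ x y, 0 < K x y)
    (hK3 : ∀ x y, K x y = ⊤ ↔ x = y)
    (hK4 : ∃ ν : ℝ → ℝ,
      ContinuousOn ν (Set.Ioi 0) ∧
      ConcaveOn ℝ (Set.Ioi 0) ν ∧
      StrictMonoOn ν (Set.Ioi 0) ∧
      Set.MapsTo ν (Set.Ioi 0) (Set.Ioi 0) ∧
      Set.SurjOn ν (Set.Ioi 0) (Set.Ioi 0) ∧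
      (∀ l : ℝ, 0 < l → ν l < l) ∧
      (∀ l : ℝ, 0 < l → ∀ x y z : X,
        ENNReal.ofReal l < K x y → ENNReal.ofReal l < K y z →
          ENNReal.ofReal (ν l) < K x z)) :
    ∃ (ρ : X → X → ℝ) (β : ℝ) (h : X → X → ℝ) (φ : ℝ → ℝ),
      -- ρ is a metric on X
      (∀ x y, 0 ≤ ρ x y) ∧
      (∀ x y, ρ x y = ρ y x) ∧
      (∀ x y, ρ x y = 0 ↔ x = y) ∧
      (∀ x y z, ρ x z ≤ ρ x y + ρ y z) ∧
      -- β ≥ 1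
      1 ≤ β ∧
      -- bounds on h
      (∀ x y, (2 : ℝ) ^ (-(1 / β)) ≤ h x y ∧ h x y ≤ 4) ∧
      -- φ is continuous, decreasing and positive on (0,∞), with φ(0⁺)=+∞ and φ(∞)=0
      ContinuousOn φ (Set.Ioi 0) ∧
      StrictAntiOn φ (Set.Ioi 0) ∧
      (∀ r : ℝ, 0 < r → 0 < φ r) ∧
      Filter.Tendsto φ (nhdsWithin 0 (Set.Ioi 0)) Filter.atTop ∧
      Filter.Tendsto φ Filter.atTop (nhds 0) ∧
      -- Newtonian representation off the diagonal
      (∀ x y, x ≠ y → K x y = ENNReal.ofReal (φ (h x y * ρ x y))) := by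
  obtain ⟨ν, -, -, hν1, hν2, hν3, hν4, hν5⟩ := hK4
  let e : Set.Ioi (0:ℝ) → Set.Ioi (0:ℝ) := fun l => ⟨ν l, hν2 l.2⟩
  have he1 : StrictMono e := fun a b hab => hν1 a.2 b.2 hab
  have he2 : Function.Surjective e := by
    intro y
    obtain ⟨x, hx, hxy⟩ := hν3 y.2
    exact ⟨⟨x, hx⟩, Subtype.ext hxy⟩
  let E := he1.orderIsoOfSurjective e he2
  have hEv : ∀ l, (E l : ℝ) = ν l := fun l => rfl
  obtain ⟨φ, hφ1, hφ2, hφ3, hφ4⟩ := exists_profile E (fun l => hν4 l l.2)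
  have hpos : ∀ t, 0 < (φ t : ℝ) := fun t => (φ t).2
  have hg : ∀ k : ENNReal, 0 < k → ∃ d : NNReal, (d = 0 ↔ k = ⊤) ∧
      (∀ t : NNReal, 0 < t → (d < t ↔ ENNReal.ofReal (φ t) < k)) ∧
      (k ≠ ⊤ → k = ENNReal.ofReal (φ d)) := by
    intro k hk
    by_cases htop : k = ⊤
    · subst htop
      exact ⟨0, by simp, fun t ht => by simp [ht], by simp⟩
    · obtain ⟨t, ht, hty⟩ := hφ2 ⟨k.toReal, ENNReal.toReal_pos hk.ne' htop⟩
      have hkφ : k = ENNReal.ofReal (φ t) := by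
        rw [hty, ENNReal.ofReal_toReal htop]
      refine ⟨⟨t, ht.le⟩, ?_, ?_, ?_⟩
      · simp only [htop, iff_false]
        intro h0
        exact ht.ne' (congrArg NNReal.toReal h0)
      · intro u hu
        rw [hkφ, ENNReal.ofReal_lt_ofReal_iff (hpos t)]
        have := hφ1.lt_iff_gt (a := (u:ℝ)) (b := t) (by exact_mod_cast hu) ht
        rw [Subtype.coe_lt_coe, this]
        rfl
      · intro _; exact hkφ
  choose! g hg1 hg2 hg3 using hg
  let d : X → X → NNReal := fun x y => g (K x y)
  have hd0 : ∀ x y, d x y = 0 ↔ x = y := fun x y => (hg1 _ (hK2 x y)).trans (hK3 x y)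
  have hdc : ∀ x y, d x y = d y x := fun x y => by simp only [d, hK1 x y]
  have hdt : ∀ x y (t : NNReal), 0 < t → (d x y < t ↔ ENNReal.ofReal (φ t) < K x y) :=
    fun x y => hg2 _ (hK2 x y)
  have hd4 : ∀ x₁ x₂ x₃ x₄, d x₁ x₄ ≤ 2 * max (d x₁ x₂) (max (d x₂ x₃) (d x₃ x₄)) := by
    intro x₁ x₂ x₃ x₄
    have key : ∀ t : NNReal, max (d x₁ x₂) (max (d x₂ x₃) (d x₃ x₄)) < t → d x₁ x₄ < 2 * t := by
      intro t ht
      have ht0 : 0 < t := lt_of_le_of_lt zero_le ht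
      simp only [max_lt_iff] at ht
      obtain ⟨h12, h23, h34⟩ := ht
      rw [hdt _ _ _ ht0] at h12 h23 h34
      rw [hdt _ _ _ (by positivity)]
      have h13 := hν5 _ (hpos t) _ _ _ h12 h23
      have h34' : ENNReal.ofReal (ν (φ t)) < K x₃ x₄ :=
        lt_of_le_of_lt (ENNReal.ofReal_le_ofReal (hν4 _ (hpos t)).le) h34
      have h14 := hν5 _ (hν2 (hpos t)) _ _ _ h13 h34'
      have : (φ ((2 * t : NNReal) : ℝ) : ℝ) = ν (ν (φ t)) := by
        push_cast
        rw [hφ3 _ (by exact_mod_cast ht0)]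
        rfl
      rwa [this]
    by_contra! hcon
    have h2 : max (d x₁ x₂) (max (d x₂ x₃) (d x₃ x₄)) < d x₁ x₄ / 2 := by
      rw [lt_div_iff₀ (by norm_num), mul_comm]; exact hcon
    have := key _ h2
    rw [mul_div_cancel₀ _ (by norm_num)] at this
    exact lt_irrefl _ this
  have hself : ∀ x, d x x = 0 := fun x => (hd0 x x).2 rfl
  let M := PseudoMetricSpace.ofPreNNDist d hself hdc
  have hle : ∀ x y, dist x y ≤ d x y := PseudoMetricSpace.dist_ofPreNNDist_le d hself hdc
  have hge : ∀ x y, (d x y : ℝ) ≤ 2 * dist x y :=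
    PseudoMetricSpace.le_two_mul_dist_ofPreNNDist d hself hdc hd4
  have hdpos : ∀ x y, x ≠ y → 0 < (d x y : ℝ) := fun x y hxy =>
    NNReal.coe_pos.2 (pos_iff_ne_zero.2 (fun h0 => hxy ((hd0 x y).1 h0)))
  have hρpos : ∀ x y, x ≠ y → 0 < dist x y := fun x y hxy => by
    have := hdpos x y hxy; have := hge x y; linarith
  classical
  refine ⟨fun x y => dist x y, 1, fun x y => if x = y then 1 else d x y / dist x y,
    fun t => φ t, fun x y => dist_nonneg, fun x y => dist_comm x y, ?_,
    fun x y z => dist_triangle x y z, le_rfl, ?_, ?_, ?_, ?_, ?_, ?_, ?_⟩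
  · intro x y
    refine ⟨fun h0 => ?_, fun h0 => by rw [h0]; exact dist_self y⟩
    by_contra hne
    exact (hρpos x y hne).ne' h0
  · intro x y
    have h12 : (2:ℝ) ^ (-(1 / (1:ℝ))) = 1 / 2 := by
      rw [div_one, Real.rpow_neg_one]; norm_num
    rw [h12]
    by_cases hxy : x = y
    · simp only [hxy, if_true]; norm_num
    · simp only [hxy, if_false]
      have h1 := hρpos x y hxy
      have h2 := hle x y
      have h3 := hge x y
      rw [le_div_iff₀ h1, div_le_iff₀ h1]
      constructor <;> linarith
  · exact continuous_subtype_val.comp_continuousOn hφ4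
  · intro s hs t ht hst
    exact hφ1 hs ht hst
  · intro r _; exact hpos r
  · rw [Filter.tendsto_atTop]
    intro b
    obtain ⟨t, ht, hty⟩ := hφ2 ⟨max b 1, by simp⟩
    filter_upwards [Ioo_mem_nhdsGT ht] with s hs
    have h1 : φ t < φ s := hφ1 hs.1 ht hs.2
    have h2 : (φ t : ℝ) < φ s := h1
    have h3 : (φ t : ℝ) = max b 1 := by rw [hty]
    have := le_max_left b 1
    linarith
  · rw [Metric.tendsto_atTop]
    intro ε hε
    obtain ⟨t, ht, hty⟩ := hφ2 ⟨ε, hε⟩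
    refine ⟨t + 1, fun s hs => ?_⟩
    have h1 : φ s < φ t := hφ1 ht (show 0 < s by linarith) (by linarith)
    have h2 : (φ s : ℝ) < φ t := h1
    have h3 : (φ t : ℝ) = ε := by rw [hty]
    rw [Real.dist_eq, sub_zero, abs_of_pos (hpos s)]
    linarith
  · intro x y hxy
    have h1 := hg3 _ (hK2 x y) (fun h => hxy ((hK3 x y).1 h))
    simp only [hxy, if_false]
    rw [div_mul_cancel₀ _ (hρpos x y hxy).ne']
    exact h1
end

section
/- Let X be a set and let V : (0,∞) → 𝒫(X × X) be a one-parameter family of subsets of X × X satisfying: (S1) each V(r) is symmetric, i.e. (x,y) ∈ V(r) iff (y,x) ∈ V(r); (S2) the diagonal Δ = {(x,x) : x ∈ X} is contained in V(r) for every r > 0; (S3) V(r₁) ⊆ V(r₂) whenever 0 < r₁ ≤ r₂; (S4) ⋃_{r>0} V(r) = X × X; (S5) ⋂_{r>0} V(r) ⊆ Δ; (S6) there exists T ≥ 1 such that V(r) ∘ V(r) ⊆ V(Tr) for every r > 0. Then the function δ(x,y) = inf{r > 0 : (x,y) ∈ V(r)} is a quasi-metric on X with constant τ ≤ T, and moreover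 for every γ > 0 and every r > 0 one has V_δ(r) ⊆ V(r) ⊆ V_δ((1+γ)r), where V_δ(s) = {(x,y) ∈ X × X : δ(x,y) < s}. -/
/-- Composition of two subsets of `X × X`:
`comp V U = {(x,z) : ∃ y, (x,y) ∈ U ∧ (y,z) ∈ V}` (this is `V ∘ U`). -/
def comp {X : Type*} (V U : Set (X × X)) : Set (X × X) :=
  {p | ∃ y, (p.1, y) ∈ U ∧ (y, p.2) ∈ V}

/-- a one-parameter family of stripes satisfying (S1)–(S6) induces, via
`δ(x,y) = inf {r > 0 : (x,y) ∈ V(r)}`, a quasi-metric with constant `τ ≤ T`; moreover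
`V_δ(r) ⊆ V(r) ⊆ V_δ((1+γ)r)` for every `γ > 0` and `r > 0`. -/
theorem quasimetric_from_stripes
    {X : Type*} (V : ℝ → Set (X × X)) (T : ℝ) (hT : 1 ≤ T)
    -- (S1)
    (hS1 : ∀ r : ℝ, 0 < r → ∀ x y : X, (x, y) ∈ V r ↔ (y, x) ∈ V r)
    -- (S2)
    (hS2 : ∀ r : ℝ, 0 < r → Set.diagonal X ⊆ V r)
    -- (S3)
    (hS3 : ∀ r₁ r₂ : ℝ, 0 < r₁ → r₁ ≤ r₂ → V r₁ ⊆ V r₂)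
    -- (S4)
    (hS4 : (⋃ r ∈ Set.Ioi (0 : ℝ), V r) = Set.univ)
    -- (S5)
    (hS5 : (⋂ r ∈ Set.Ioi (0 : ℝ), V r) ⊆ Set.diagonal X)
    -- (S6)
    (hS6 : ∀ r : ℝ, 0 < r → comp (V r) (V r) ⊆ V (T * r))
    (δ : X → X → ℝ)
    (hδ : ∀ x y, δ x y = sInf {r : ℝ | 0 < r ∧ (x, y) ∈ V r}) :
    -- δ is a quasi-metric on X with constant τ ≤ T
    (∀ x y, 0 ≤ δ x y) ∧
    (∀ x y, δ x y = δ y x) ∧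
    (∀ x y, δ x y = 0 ↔ x = y) ∧
    (∀ x y z, δ x z ≤ T * (δ x y + δ y z)) ∧
    -- the stripes of δ are equivalent to the original family
    (∀ γ : ℝ, 0 < γ → ∀ r : ℝ, 0 < r →
      {p : X × X | δ p.1 p.2 < r} ⊆ V r ∧
      V r ⊆ {p : X × X | δ p.1 p.2 < (1 + γ) * r}) := by
  have hbdd : ∀ x y : X, BddBelow {r : ℝ | 0 < r ∧ (x, y) ∈ V r} :=
    fun x y => ⟨0, fun r hr => hr.1.le⟩
  have hle : ∀ x y r, 0 < r → (x, y) ∈ V r → δ x y ≤ r := by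
    intro x y r hr h
    rw [hδ]
    exact csInf_le (hbdd x y) ⟨hr, h⟩
  have hne : ∀ x y : X, {r : ℝ | 0 < r ∧ (x, y) ∈ V r}.Nonempty := by
    intro x y
    have h : (x, y) ∈ (⋃ r ∈ Set.Ioi (0 : ℝ), V r) := by
      rw [hS4]
      exact Set.mem_univ _
    simp only [Set.mem_iUnion, Set.mem_Ioi] at h
    obtain ⟨r, hr, h⟩ := h
    exact ⟨r, hr, h⟩
  have hlt : ∀ x y r, δ x y < r → (x, y) ∈ V r := by
    intro x y r h
    rw [hδ] at h
    obtain ⟨s, ⟨hs, hm⟩, hsr⟩ := exists_lt_of_csInf_lt (hne x y) h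
    exact hS3 s r hs hsr.le hm
  have hnn : ∀ x y, 0 ≤ δ x y := by
    intro x y
    rw [hδ]
    exact Real.sInf_nonneg fun r hr => hr.1.le
  refine ⟨hnn, ?_, ?_, ?_, ?_⟩
  · intro x y
    rw [hδ, hδ]
    congr 1
    ext r
    exact and_congr_right fun hr => hS1 r hr x y
  · intro x y
    constructor
    · intro h
      have hm : (x, y) ∈ (⋂ r ∈ Set.Ioi (0 : ℝ), V r) := by
        simp only [Set.mem_iInter, Set.mem_Ioi]
        intro r hr
        exact hlt x y r (by rw [h]; exact hr)
      exact hS5 hm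
    · rintro rfl
      refine le_antisymm (le_of_forall_pos_le_add fun ε hε => ?_) (hnn x x)
      rw [zero_add]
      exact hle x x ε hε (hS2 ε hε rfl)
  · intro x y z
    have hT0 : 0 < T := by linarith
    have h1 := hnn x y
    have h2 := hnn y z
    refine le_of_forall_pos_le_add fun ε hε => ?_
    have hq : 0 < ε / T := div_pos hε hT0
    have hs : 0 < δ x y + δ y z + ε / T := by linarith
    have hm := hS6 _ hs (show (x, z) ∈ comp _ _ from
      ⟨y, hlt x y _ (by linarith), hlt y z _ (by linarith)⟩)
    have h := hle x z _ (mul_pos hT0 hs) hm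
    have he : T * (ε / T) = ε := by field_simp
    rw [mul_add, he] at h
    exact h
  · intro γ hγ r hr
    refine ⟨fun p hp => hlt p.1 p.2 r hp, fun p hp => ?_⟩
    have h := hle p.1 p.2 r hr hp
    have := mul_pos hγ hr
    show δ p.1 p.2 < (1 + γ) * r
    linarith
end

section
/- Let X be a set and let V : (0,∞) → 𝒫(X × X) satisfy conditions (S1)–(S6): (S1) each V(r) is symmetric; (S2) the diagonal Δ ⊆ V(r) for every r > 0; (S3) V(r₁) ⊆ V(r₂) for 0 < r₁ ≤ r₂; (S4) ⋃_{r>0} V(r) = X × X; (S5) ⋂_{r>0} V(r) ⊆ Δ; (S6) there exists T ≥ 1 with V(r) ∘ V(r) ⊆ V(Tr) for all r > 0. Let δ(x,y) = inf{r > 0 : (x,y) ∈ V(r)}. Then there exist a constant β ≥ 1 and a metric ρ on X such that (i) 4^(−β)·δ(x,y) ≤ ρ(x,y)^β ≤ 2^β·δ(x,y) for all x,y ∈ X, and (ii) V_{ρ^β}(r/4^β) ⊆ V(r) ⊆ V_{ρ^β}(2^(β+1)·r) for every r > 0, where V_{ρ^β}(s) = {(x,y) ∈ X × X : ρ(x,y)^β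 < s}. -/
/-- for a family of stripes satisfying (S1)–(S6) and the induced
`δ(x,y) = inf {r > 0 : (x,y) ∈ V(r)}`, there are `β ≥ 1` and a metric `ρ` with
(i) `4^(-β) δ ≤ ρ^β ≤ 2^β δ` and
(ii) `V_{ρ^β}(r/4^β) ⊆ V(r) ⊆ V_{ρ^β}(2^(β+1) r)` for every `r > 0`. -/
theorem metrization_of_stripes
    {X : Type*} (V : ℝ → Set (X × X)) (T : ℝ) (hT : 1 ≤ T)
    -- (S1)
    (hS1 : ∀ r : ℝ, 0 < r → ∀ x y : X, (x, y) ∈ V r ↔ (y, x) ∈ V r)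
    -- (S2)
    (hS2 : ∀ r : ℝ, 0 < r → Set.diagonal X ⊆ V r)
    -- (S3)
    (hS3 : ∀ r₁ r₂ : ℝ, 0 < r₁ → r₁ ≤ r₂ → V r₁ ⊆ V r₂)
    -- (S4)
    (hS4 : (⋃ r ∈ Set.Ioi (0 : ℝ), V r) = Set.univ)
    -- (S5)
    (hS5 : (⋂ r ∈ Set.Ioi (0 : ℝ), V r) ⊆ Set.diagonal X)
    -- (S6)
    (hS6 : ∀ r : ℝ, 0 < r → comp (V r) (V r) ⊆ V (T * r))
    (δ : X → X → ℝ)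
    (hδ : ∀ x y, δ x y = sInf {r : ℝ | 0 < r ∧ (x, y) ∈ V r}) :
    ∃ (β : ℝ) (ρ : X → X → ℝ),
      1 ≤ β ∧
      -- ρ is a metric on X
      (∀ x y, 0 ≤ ρ x y) ∧
      (∀ x y, ρ x y = ρ y x) ∧
      (∀ x y, ρ x y = 0 ↔ x = y) ∧
      (∀ x y z, ρ x z ≤ ρ x y + ρ y z) ∧
      -- (i)
      (∀ x y, (4 : ℝ) ^ (-β) * δ x y ≤ ρ x y ^ β ∧ ρ x y ^ β ≤ (2 : ℝ) ^ β * δ x y) ∧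
      -- (ii)
      (∀ r : ℝ, 0 < r →
        {p : X × X | ρ p.1 p.2 ^ β < r / (4 : ℝ) ^ β} ⊆ V r ∧
        V r ⊆ {p : X × X | ρ p.1 p.2 ^ β < (2 : ℝ) ^ (β + 1) * r}) := by
  classical
  have hne : ∀ x y, ∃ r : ℝ, 0 < r ∧ (x, y) ∈ V r := by
    intro x y
    have h : (x, y) ∈ (⋃ r ∈ Set.Ioi (0 : ℝ), V r) := by rw [hS4]; trivial
    simp only [Set.mem_iUnion, Set.mem_Ioi] at h
    obtain ⟨r, h1, h2⟩ := h
    exact ⟨r, h1, h2⟩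
  have hbdd : ∀ x y, BddBelow {r : ℝ | 0 < r ∧ (x, y) ∈ V r} :=
    fun x y => ⟨0, fun r hr => hr.1.le⟩
  have hle : ∀ x y r, 0 < r → (x, y) ∈ V r → δ x y ≤ r := by
    intro x y r hr h
    rw [hδ]
    exact csInf_le (hbdd x y) ⟨hr, h⟩
  have h0 : ∀ x y, 0 ≤ δ x y := by
    intro x y
    rw [hδ]
    exact Real.sInf_nonneg (fun r hr => hr.1.le)
  have hlt : ∀ x y r, δ x y < r → (x, y) ∈ V r := by
    intro x y r h
    rw [hδ] at h
    obtain ⟨s, hs, hsr⟩ := exists_lt_of_csInf_lt (hne x y) h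
    exact hS3 s r hs.1 hsr.le hs.2
  have hsymm : ∀ x y, δ x y = δ y x := by
    intro x y
    rw [hδ, hδ]
    congr 1
    ext r
    exact ⟨fun h => ⟨h.1, (hS1 r h.1 x y).1 h.2⟩, fun h => ⟨h.1, (hS1 r h.1 x y).2 h.2⟩⟩
  have hself : ∀ x, δ x x = 0 := by
    intro x
    refine le_antisymm (le_of_forall_pos_le_add fun ε hε => ?_) (h0 x x)
    rw [zero_add]
    exact hle x x ε hε (hS2 ε hε rfl)
  have hzero : ∀ x y, δ x y = 0 → x = y := by
    intro x y h
    have : (x, y) ∈ (⋂ r ∈ Set.Ioi (0 : ℝ), V r) := by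
      simp only [Set.mem_iInter, Set.mem_Ioi]
      intro r hr
      exact hlt x y r (h ▸ hr)
    exact hS5 this
  have hT0 : 0 < T := by linarith
  have htri : ∀ x y z m, δ x y ≤ m → δ y z ≤ m → δ x z ≤ T * m := by
    intro x y z m h1 h2
    have : ∀ r, m < r → δ x z ≤ T * r := by
      intro r hr
      have hr0 : 0 < r := lt_of_le_of_lt ((h0 x y).trans h1) hr
      exact hle x z _ (by positivity)
        (hS6 r hr0 ⟨y, hlt x y r (by linarith), hlt y z r (by linarith)⟩)
    have h3 : δ x z / T ≤ m := le_of_forall_gt_imp_ge_of_dense fun r hr => by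
      rw [div_le_iff₀ hT0]; linarith [this r hr]
    rw [div_le_iff₀ hT0] at h3
    linarith
  have htri3 : ∀ x y z w m, δ x y ≤ m → δ y z ≤ m → δ z w ≤ m → δ x w ≤ T ^ 2 * m := by
    intro x y z w m h1 h2 h3
    have hm : 0 ≤ m := (h0 x y).trans h1
    have := htri x z w (T * m) (htri x y z m h1 h2) (by nlinarith)
    nlinarith
  obtain ⟨n, hn⟩ := pow_unbounded_of_one_lt (T ^ 2) (one_lt_two)
  obtain ⟨β, hβ1, hβT⟩ : ∃ β : ℝ, 1 ≤ β ∧ T ^ 2 ≤ (2 : ℝ) ^ β := by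
    refine ⟨(n + 1 : ℕ), by simp, ?_⟩
    rw [Real.rpow_natCast, pow_succ (2 : ℝ)]
    nlinarith [sq_nonneg T]
  have hβ0 : 0 < β := by linarith
  let d : X → X → NNReal := fun x y => ⟨δ x y ^ β⁻¹, Real.rpow_nonneg (h0 x y) _⟩
  have hd : ∀ x y, ((d x y : NNReal) : ℝ) = δ x y ^ β⁻¹ := fun x y => rfl
  have hdβ : ∀ x y, ((d x y : NNReal) : ℝ) ^ β = δ x y := fun x y => by
    rw [hd, Real.rpow_inv_rpow (h0 x y) hβ0.ne']
  have dself : ∀ x, d x x = 0 := by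
    intro x
    apply NNReal.coe_injective
    rw [hd, hself, Real.zero_rpow (inv_pos.2 hβ0).ne', NNReal.coe_zero]
  have dcomm : ∀ x y, d x y = d y x := by
    intro x y
    apply NNReal.coe_injective
    rw [hd, hd, hsymm]
  have hd3 : ∀ x₁ x₂ x₃ x₄, d x₁ x₄ ≤ 2 * max (d x₁ x₂) (max (d x₂ x₃) (d x₃ x₄)) := by
    intro a b c e
    set m := max (d a b) (max (d b c) (d c e)) with hm
    have key : ∀ x y, d x y ≤ m → δ x y ≤ (m : ℝ) ^ β := by
      intro x y h
      rw [← hdβ x y]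
      exact Real.rpow_le_rpow (d x y).2 (by exact_mod_cast h) hβ0.le
    have h3 := htri3 a b c e ((m : ℝ) ^ β) (key _ _ (le_max_left _ _))
      (key _ _ ((le_max_left _ _).trans (le_max_right _ _)))
      (key _ _ ((le_max_right _ _).trans (le_max_right _ _)))
    have hmn : (0 : ℝ) ≤ (m : ℝ) ^ β := Real.rpow_nonneg m.2 _
    have h4 : ((d a e : NNReal) : ℝ) ^ β ≤ (2 * (m : ℝ)) ^ β := by
      rw [hdβ, Real.mul_rpow (by norm_num) m.coe_nonneg]
      exact h3.trans (mul_le_mul_of_nonneg_right hβT hmn)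
    have h5 := (Real.rpow_le_rpow_iff (d a e).2 (by positivity) hβ0).1 h4
    exact_mod_cast h5
  letI P : PseudoMetricSpace X := PseudoMetricSpace.ofPreNNDist d dself dcomm
  have hup : ∀ x y : X, dist x y ≤ d x y := PseudoMetricSpace.dist_ofPreNNDist_le d dself dcomm
  have hlo : ∀ x y : X, (d x y : ℝ) ≤ 2 * dist x y :=
    PseudoMetricSpace.le_two_mul_dist_ofPreNNDist d dself dcomm hd3
  have hi1 : ∀ x y : X, (4 : ℝ) ^ (-β) * δ x y ≤ dist x y ^ β := by
    intro x y
    rw [Real.rpow_neg (by norm_num), inv_mul_le_iff₀ (by positivity),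
      ← Real.mul_rpow (by norm_num) dist_nonneg, ← hdβ x y]
    exact Real.rpow_le_rpow (d x y).2
      ((hlo x y).trans (by linarith [dist_nonneg (x := x) (y := y)])) hβ0.le
  have hi2 : ∀ x y : X, dist x y ^ β ≤ (2 : ℝ) ^ β * δ x y := by
    intro x y
    have h1 : dist x y ^ β ≤ δ x y := by
      rw [← hdβ x y]
      exact Real.rpow_le_rpow dist_nonneg (hup x y) hβ0.le
    have h2 : (1 : ℝ) ≤ 2 ^ β := Real.one_le_rpow (by norm_num) hβ0.le
    nlinarith [h0 x y]
  refine ⟨β, fun x y => dist x y, hβ1, fun x y => dist_nonneg, fun x y => dist_comm x y, ?_,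
    fun x y z => dist_triangle x y z, fun x y => ⟨hi1 x y, hi2 x y⟩, fun r hr => ⟨?_, ?_⟩⟩
  · intro x y
    constructor
    · intro h
      apply hzero
      have h1 := hlo x y
      have h2 : ((d x y : NNReal) : ℝ) = 0 :=
        le_antisymm (by rw [show dist x y = 0 from h] at h1; linarith) (d x y).2
      rw [← hdβ x y, h2, Real.zero_rpow hβ0.ne']
    · rintro rfl
      exact dist_self _
  · rintro ⟨x, y⟩ h
    have h : dist x y ^ β < r / (4 : ℝ) ^ β := h
    have h1 := hi1 x y
    rw [Real.rpow_neg (by norm_num), inv_mul_le_iff₀ (by positivity)] at h1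
    rw [lt_div_iff₀ (by positivity)] at h
    exact hlt x y r (by linarith)
  · rintro ⟨x, y⟩ h
    change dist x y ^ β < (2 : ℝ) ^ (β + 1) * r
    have h1 := hi2 x y
    have h2 := hle x y r hr h
    have h3 : (0 : ℝ) < 2 ^ β := by positivity
    rw [Real.rpow_add (by norm_num), Real.rpow_one]
    have h4 := mul_le_mul_of_nonneg_left h2 h3.le
    have h5 := mul_pos h3 hr
    linarith
end

section
/- Let d be a quasi-metric on a set X with constant τ ≥ 1. Then there exist a real number β ≥ 1, a metric ρ on X, and positive constants a₁, a₂ such that a₁·d(x,y) ≤ ρ(x,y)^β ≤ a₂·d(x,y) for every x and y in X. -/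
/-- Macías–Segovia metrization: every quasi-metric `d` on `X` is equivalent to
a power of a metric: there exist `β ≥ 1`, a metric `ρ` on `X` and positive constants
`a₁, a₂` with `a₁·d(x,y) ≤ ρ(x,y)^β ≤ a₂·d(x,y)` for all `x, y`. -/
theorem quasimetric_equivalent_to_power_of_metric
    {X : Type*} (d : X → X → ℝ) (τ : ℝ) (hτ : 1 ≤ τ)
    (hnonneg : ∀ x y, 0 ≤ d x y)
    (hsymm : ∀ x y, d x y = d y x)
    (hzero : ∀ x y, d x y = 0 ↔ x = y)
    (htriangle : ∀ x y z, d x z ≤ τ * (d x y + d y z)) :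
    ∃ (β : ℝ) (ρ : X → X → ℝ) (a₁ a₂ : ℝ),
      1 ≤ β ∧ 0 < a₁ ∧ 0 < a₂ ∧
      -- ρ is a metric on X
      (∀ x y, 0 ≤ ρ x y) ∧
      (∀ x y, ρ x y = ρ y x) ∧
      (∀ x y, ρ x y = 0 ↔ x = y) ∧
      (∀ x y z, ρ x z ≤ ρ x y + ρ y z) ∧
      -- equivalence
      (∀ x y, a₁ * d x y ≤ ρ x y ^ β ∧ ρ x y ^ β ≤ a₂ * d x y) := by
  have hK : (2:ℝ) ≤ 3 * τ ^ 2 := by nlinarith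
  have hK0 : (0:ℝ) < 3 * τ ^ 2 := by linarith
  obtain ⟨β, hβ⟩ : ∃ β : ℝ, β = Real.logb 2 (3 * τ ^ 2) := ⟨_, rfl⟩
  have hβ1 : 1 ≤ β := by
    rw [hβ, Real.le_logb_iff_rpow_le (by norm_num) hK0]
    simpa using hK
  have hβ0 : 0 < β := by linarith
  have h2β : (2:ℝ) ^ β = 3 * τ ^ 2 := by
    rw [hβ]; exact Real.rpow_logb (by norm_num) (by norm_num) hK0
  have hcancel : ∀ t : ℝ, 0 ≤ t → (t ^ β⁻¹) ^ β = t := fun t ht =>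
    Real.rpow_inv_rpow ht hβ0.ne'
  let e : X → X → NNReal := fun x y => ⟨d x y ^ β⁻¹, Real.rpow_nonneg (hnonneg x y) _⟩
  have he : ∀ x y, ((e x y : NNReal) : ℝ) = d x y ^ β⁻¹ := fun x y => rfl
  have heβ : ∀ x y, ((e x y : NNReal) : ℝ) ^ β = d x y := fun x y => by
    rw [he]; exact hcancel _ (hnonneg x y)
  have eself : ∀ x, e x x = 0 := fun x => by
    apply NNReal.coe_injective
    rw [he, (hzero x x).2 rfl, Real.zero_rpow (inv_ne_zero hβ0.ne')]
    rfl
  have ecomm : ∀ x y, e x y = e y x := fun x y => by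
    apply NNReal.coe_injective
    rw [he, he, hsymm]
  have hd4 : ∀ x₁ x₂ x₃ x₄, e x₁ x₄ ≤ 2 * max (e x₁ x₂) (max (e x₂ x₃) (e x₃ x₄)) := by
    intro x₁ x₂ x₃ x₄
    obtain ⟨M, hM⟩ : ∃ M, M = max (e x₁ x₂) (max (e x₂ x₃) (e x₃ x₄)) := ⟨_, rfl⟩
    rw [← hM]
    have h1 : e x₁ x₂ ≤ M := by rw [hM]; exact le_max_left _ _
    have h2 : e x₂ x₃ ≤ M := by
      rw [hM]; exact (le_max_left _ _).trans (le_max_right _ _)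
    have h3 : e x₃ x₄ ≤ M := by
      rw [hM]; exact (le_max_right _ _).trans (le_max_right _ _)
    have key : ∀ x y, e x y ≤ M → d x y ≤ (M : ℝ) ^ β := fun x y h => by
      rw [← heβ x y]
      exact Real.rpow_le_rpow (e x y).2 (NNReal.coe_le_coe.2 h) hβ0.le
    have k1 := key _ _ h1
    have k2 := key _ _ h2
    have k3 := key _ _ h3
    have hN : 0 ≤ (M : ℝ) ^ β := Real.rpow_nonneg M.2 _
    have t1 := htriangle x₁ x₂ x₄
    have t2 := htriangle x₂ x₃ x₄
    have hτ0 : 0 ≤ τ := by linarith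
    have hfin : d x₁ x₄ ≤ 3 * τ ^ 2 * (M : ℝ) ^ β := by
      generalize (M : ℝ) ^ β = N at *
      calc d x₁ x₄ ≤ τ * (d x₁ x₂ + d x₂ x₄) := t1
        _ ≤ τ * (N + τ * (N + N)) := by
          apply mul_le_mul_of_nonneg_left _ hτ0
          apply add_le_add k1 (t2.trans _)
          exact mul_le_mul_of_nonneg_left (add_le_add k2 k3) hτ0
        _ ≤ 3 * τ ^ 2 * N := by
          nlinarith [mul_nonneg (mul_nonneg hτ0 (sub_nonneg.2 hτ)) hN]
    rw [← NNReal.coe_le_coe]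
    refine (Real.rpow_le_rpow_iff (NNReal.coe_nonneg _) (NNReal.coe_nonneg _) hβ0).1 ?_
    change ((e x₁ x₄ : NNReal) : ℝ) ^ β ≤ ((2 * M : NNReal) : ℝ) ^ β
    rw [heβ, NNReal.coe_mul, Real.mul_rpow (by positivity) (by positivity)]
    simpa [h2β] using hfin
  let P := PseudoMetricSpace.ofPreNNDist e eself ecomm
  have hle : ∀ x y, P.dist x y ≤ e x y := PseudoMetricSpace.dist_ofPreNNDist_le e eself ecomm
  have hge : ∀ x y, (e x y : ℝ) ≤ 2 * P.dist x y :=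
    PseudoMetricSpace.le_two_mul_dist_ofPreNNDist e eself ecomm hd4
  have hnn : ∀ x y, 0 ≤ P.dist x y := fun x y => @dist_nonneg X P x y
  have hlow : ∀ x y, d x y ≤ 3 * τ ^ 2 * P.dist x y ^ β := fun x y => by
    rw [← h2β, ← Real.mul_rpow (by norm_num) (hnn x y), ← heβ x y]
    exact Real.rpow_le_rpow (e x y).2 (hge x y) hβ0.le
  refine ⟨β, P.dist, (3 * τ ^ 2)⁻¹, 1, hβ1, inv_pos.2 hK0, one_pos, hnn, P.dist_comm, ?_,
    P.dist_triangle, fun x y => ⟨?_, ?_⟩⟩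
  · intro x y
    constructor
    · intro h
      have := hlow x y
      rw [h, Real.zero_rpow hβ0.ne', mul_zero] at this
      exact (hzero x y).1 (le_antisymm this (hnonneg x y))
    · rintro rfl
      exact P.dist_self x
  · rw [inv_mul_le_iff₀ hK0]
    exact hlow x y
  · rw [one_mul, ← heβ x y]
    exact Real.rpow_le_rpow (hnn x y) (hle x y) hβ0.le
end

section
/- Let ν : (0,∞) → (0,∞) be a concave, continuous, strictly increasing function, surjective onto (0,∞), such that ν(λ) < λ for every λ > 0. Then, given any M > 1, there exists a continuous, strictly decreasing and convex function ψ : (0,∞) → (0,∞) with ψ(1) = 1, ψ(λ) → +∞ as λ → 0⁺, ψ(λ) → 0 as λ → ∞, such that the inequality ψ(ν(λ)) ≤ M·ψ(λ) holds for every λ > 0. -/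
/-- A slowly growing convex profile adapted to a sequence decreasing to `0`. -/
theorem aux_f (x : ℕ → ℝ) (hpos : ∀ n, 0 < x n) (hanti : Antitone x) (h0 : x 0 = 1)
    (hlim : ∀ e : ℝ, 0 < e → ∃ n, x n < e) :
    ∃ f : ℝ → ℝ, (∀ l, 0 ≤ f l) ∧ (ConvexOn ℝ (Set.Ioi 0) f) ∧ (AntitoneOn f (Set.Ioi 0)) ∧
      (∀ n, f (x n) ≤ n) ∧ (∀ l, 1 ≤ l → f l = 0) ∧
      (∀ a b, 0 < a → a < b → a < 1 → f b < f a) ∧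
      (∀ K : ℝ, ∃ d : ℝ, 0 < d ∧ ∀ l, 0 < l → l < d → K ≤ f l) := by
  let g : ℕ → ℝ → ℝ := fun k l => max 0 (1 - l / x k)
  have g0 : ∀ k l, 0 ≤ g k l := fun k l => le_max_left _ _
  have gz : ∀ k l, x k ≤ l → g k l = 0 := by
    intro k l h
    apply max_eq_left
    have : 1 ≤ l / x k := (one_le_div (hpos k)).2 h
    linarith
  have ga : ∀ k a b, a ≤ b → g k b ≤ g k a := by
    intro k a b h
    have := div_le_div_of_nonneg_right h (hpos k).le
    exact max_le_max le_rfl (by linarith)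
  have g1 : ∀ k l, 0 < l → g k l ≤ 1 := by
    intro k l h
    have := div_pos h (hpos k)
    exact max_le (by norm_num) (by linarith)
  have gs : ∀ l, 0 < l → Summable (fun k => g k l) := by
    intro l hl
    obtain ⟨n, hn⟩ := hlim l hl
    apply summable_of_ne_finset_zero (s := Finset.range n)
    intro k hk
    have : n ≤ k := by simpa using hk
    exact gz k l ((hanti this).trans hn.le)
  refine ⟨fun l => ∑' k, g k l, fun l => tsum_nonneg fun k => g0 k l, ⟨convex_Ioi 0, ?_⟩, ?_, ?_, ?_,
    ?_, ?_⟩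
  · intro a ha b hb s t hs ht hst
    have hc : (0:ℝ) < s • a + t • b := (convex_Ioi (0:ℝ)) ha hb hs ht hst
    simp only [smul_eq_mul] at hc ⊢
    rw [← tsum_mul_left, ← tsum_mul_left, ← ((gs a ha).mul_left s).tsum_add ((gs b hb).mul_left t)]
    refine (gs _ hc).tsum_le_tsum ?_ (((gs a ha).mul_left s).add ((gs b hb).mul_left t))
    intro k
    apply max_le
    · have := g0 k a
      have := g0 k b
      positivity
    · have h1 : 1 - a / x k ≤ g k a := le_max_right _ _
      have h2 : 1 - b / x k ≤ g k b := le_max_right _ _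
      have h3 := mul_le_mul_of_nonneg_left h1 hs
      have h4 := mul_le_mul_of_nonneg_left h2 ht
      have h5 : 1 - (s * a + t * b) / x k = s * (1 - a / x k) + t * (1 - b / x k) := by
        linear_combination -hst
      linarith
  · intro a ha b hb hab
    exact (gs b hb).tsum_le_tsum (fun k => ga k a b hab) (gs a ha)
  · intro n
    change ∑' k, g k (x n) ≤ n
    rw [tsum_eq_sum (s := Finset.range n)]
    · calc _ ≤ ∑ k ∈ Finset.range n, (1:ℝ) := Finset.sum_le_sum fun k _ => g1 k _ (hpos n)
        _ = n := by simp
    · intro k hk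
      exact gz k _ (hanti (by simpa using hk))
  · intro l hl
    have : ∀ k, g k l = 0 := fun k => gz k l (((hanti (Nat.zero_le k)).trans h0.le).trans hl)
    simp [this]
  · intro a b ha hab h1
    refine Summable.tsum_lt_tsum (i := 0) (fun k => ga k a b hab.le) ?_ (gs b (ha.trans hab)) (gs a ha)
    simp only [g, h0, div_one]
    rw [max_eq_right (a := (0:ℝ)) (b := 1 - a) (by linarith)]
    exact max_lt (by linarith) (by linarith)
  · intro K
    obtain ⟨n, hn⟩ := exists_nat_gt (2 * K)
    refine ⟨x n / 2, by have := hpos n; positivity, fun l hl hln => ?_⟩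
    have h1 : ∑ k ∈ Finset.range n, (1/2:ℝ) ≤ ∑ k ∈ Finset.range n, g k l := by
      apply Finset.sum_le_sum
      intro k hk
      have hk : k < n := by simpa using hk
      refine le_trans ?_ (le_max_right _ _)
      have h3 := hanti hk.le
      have : l / x k ≤ 1/2 := by
        rw [div_le_iff₀ (hpos k)]; linarith
      linarith
    have h2 := (gs l hl).sum_le_tsum (Finset.range n) (fun k _ => g0 k l)
    simp at h1
    change K ≤ ∑' k, g k l
    linarith

/-- Proposition on the basic profile: if `ν : (0,∞) → (0,∞)` is concave,
continuous, strictly increasing, onto, with `ν(λ) < λ` for all `λ > 0`, then for every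
`M > 1` there is a continuous, strictly decreasing, convex `ψ : (0,∞) → (0,∞)` with
`ψ(1) = 1`, `ψ(0⁺) = +∞`, `ψ(∞) = 0` and `ψ(ν(λ)) ≤ M·ψ(λ)` for every `λ > 0`. -/
theorem profile_inequality
    (ν : ℝ → ℝ)
    (hν_conc : ConcaveOn ℝ (Set.Ioi 0) ν)
    (hν_cont : ContinuousOn ν (Set.Ioi 0))
    (hν_mono : StrictMonoOn ν (Set.Ioi 0))
    (hν_maps : Set.MapsTo ν (Set.Ioi 0) (Set.Ioi 0))
    (hν_surj : Set.SurjOn ν (Set.Ioi 0) (Set.Ioi 0))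
    (hν_lt : ∀ l : ℝ, 0 < l → ν l < l)
    (M : ℝ) (hM : 1 < M) :
    ∃ ψ : ℝ → ℝ,
      ContinuousOn ψ (Set.Ioi 0) ∧
      StrictAntiOn ψ (Set.Ioi 0) ∧
      ConvexOn ℝ (Set.Ioi 0) ψ ∧
      ψ 1 = 1 ∧
      (∀ l : ℝ, 0 < l → 0 < ψ l) ∧
      Filter.Tendsto ψ (nhdsWithin 0 (Set.Ioi 0)) Filter.atTop ∧
      Filter.Tendsto ψ Filter.atTop (nhds 0) ∧
      (∀ l : ℝ, 0 < l → ψ (ν l) ≤ M * ψ l) := by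
  have hit : ∀ n l, 0 < l → 0 < ν^[n] l := by
    intro n
    induction n with
    | zero => intro l hl; simpa using hl
    | succ n ih => intro l hl; rw [Function.iterate_succ_apply]; exact ih _ (hν_maps hl)
  have hmono : ∀ n a b, 0 < a → a < b → ν^[n] a < ν^[n] b := by
    intro n
    induction n with
    | zero => intro a b _ h; simpa using h
    | succ n ih =>
      intro a b ha h
      rw [Function.iterate_succ_apply, Function.iterate_succ_apply]
      exact ih _ _ (hν_maps ha) (hν_mono ha (ha.trans h) h)
  have hmono' : ∀ n a b, 0 < a → a ≤ b → ν^[n] a ≤ ν^[n] b := by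
    intro n a b ha h
    rcases h.eq_or_lt with h | h
    · rw [h]
    · exact (hmono n a b ha h).le
  have hconc : ∀ (n : ℕ) (a b s t : ℝ), 0 < a → 0 < b → 0 ≤ s → 0 ≤ t → s + t = 1 →
      s * ν^[n] a + t * ν^[n] b ≤ ν^[n] (s * a + t * b) := by
    intro n
    induction n with
    | zero => intro a b s t _ _ _ _ _; simp
    | succ n ih =>
      intro a b s t ha hb hs ht hst
      simp only [Function.iterate_succ_apply]
      refine (ih _ _ s t (hν_maps ha) (hν_maps hb) hs ht hst).trans ?_
      apply hmono'
      · exact (convex_Ioi (0:ℝ)) (hν_maps ha) (hν_maps hb) hs ht hst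
      · exact hν_conc.2 ha hb hs ht hst
  have hanti : ∀ l, 0 < l → Antitone (fun n => ν^[n] l) := by
    intro l hl
    apply antitone_nat_of_succ_le
    intro n
    rw [Function.iterate_succ_apply']
    exact (hν_lt _ (hit n l hl)).le
  have hlim : ∀ l, 0 < l → ∀ e : ℝ, 0 < e → ∃ n, ν^[n] l < e := by
    intro l hl e he
    by_contra! hcon
    have hb : BddBelow (Set.range fun n => ν^[n] l) := ⟨e, by rintro _ ⟨n, rfl⟩; exact hcon n⟩
    have ht := tendsto_atTop_ciInf (hanti l hl) hb
    set L := ⨅ n, ν^[n] l with hL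
    have hLe : e ≤ L := le_ciInf hcon
    have hLp : 0 < L := he.trans_le hLe
    have hc : ContinuousAt ν L := hν_cont.continuousAt (Ioi_mem_nhds hLp)
    have h1 := hc.tendsto.comp ht
    have h2 := (Filter.tendsto_add_atTop_iff_nat 1).2 ht
    have h3 : (ν ∘ fun n => ν^[n] l) = fun n => ν^[n+1] l := by
      funext n; simp [Function.iterate_succ_apply']
    rw [h3] at h1
    have := tendsto_nhds_unique h1 h2
    exact absurd this (hν_lt L hLp).ne
  obtain ⟨f, f0, fconv, fanti, fn, fz, fs, fK⟩ := aux_f (fun n => ν^[n] 1)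
    (fun n => hit n 1 one_pos) (hanti 1 one_pos) rfl (hlim 1 one_pos)
  have hM0 : 0 < M := by linarith
  have hr : ∀ n : ℕ, 0 < (M⁻¹)^n := fun n => by positivity
  have hS : ∀ l, 0 < l → Summable (fun n : ℕ => (M⁻¹)^n * f (ν^[n] l)) := by
    intro l hl
    obtain ⟨j, hj⟩ := hlim 1 one_pos l hl
    have hn : ‖M⁻¹‖ < 1 := by
      rw [Real.norm_of_nonneg (by positivity)]; exact inv_lt_one_of_one_lt₀ hM
    have s1 := summable_pow_mul_geometric_of_norm_lt_one 1 hn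
    have s2 := (summable_geometric_of_norm_lt_one hn).mul_left (j:ℝ)
    refine Summable.of_nonneg_of_le (fun n => mul_nonneg (hr n).le (f0 _)) (fun n => ?_) (s1.add s2)
    have h1 : f (ν^[n] l) ≤ f (ν^[n + j] 1) := by
      apply fanti (hit _ _ one_pos) (hit _ _ hl)
      rw [Function.iterate_add_apply]
      exact hmono' n _ _ (hit _ _ one_pos) hj.le
    have h2 := h1.trans (fn (n + j))
    have h3 := mul_le_mul_of_nonneg_left h2 (hr n).le
    push_cast at h3
    linarith
  obtain ⟨P, hP⟩ : ∃ P : ℝ → ℝ, ∀ l, P l = ∑' n : ℕ, (M⁻¹)^n * f (ν^[n] l) := ⟨_, fun _ => rfl⟩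
  have hrec : ∀ l, 0 < l → P l = f l + M⁻¹ * P (ν l) := by
    intro l hl
    rw [hP, hP, (hS l hl).tsum_eq_zero_add, ← tsum_mul_left]
    simp only [pow_zero, one_mul, Function.iterate_zero, id, Function.iterate_succ_apply, pow_succ']
    simp only [mul_assoc]
  have hPanti : StrictAntiOn P (Set.Ioi 0) := by
    intro a ha b hb hab
    rw [hP, hP]
    obtain ⟨n, hn⟩ := hlim a ha 1 one_pos
    refine Summable.tsum_lt_tsum (i := n) (fun k => ?_) ?_ (hS b hb) (hS a ha)
    · exact mul_le_mul_of_nonneg_left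
        (fanti (hit _ _ ha) (hit _ _ hb) (hmono k a b ha hab).le) (hr k).le
    · exact mul_lt_mul_of_pos_left (fs _ _ (hit _ _ ha) (hmono n a b ha hab) hn) (hr n)
  have hPnn : ∀ l, 0 ≤ P l := fun l => by
    rw [hP]; exact tsum_nonneg fun n => mul_nonneg (hr n).le (f0 _)
  have hPpos : ∀ l, 0 < l → 0 < P l := fun l hl =>
    (hPnn (l+1)).trans_lt (hPanti hl (by simp; linarith : l + 1 ∈ Set.Ioi (0:ℝ)) (by linarith))
  have hPconv : ConvexOn ℝ (Set.Ioi 0) P := by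
    refine ⟨convex_Ioi 0, ?_⟩
    intro a ha b hb s t hs ht hst
    have hc : (0:ℝ) < s • a + t • b := (convex_Ioi (0:ℝ)) ha hb hs ht hst
    simp only [smul_eq_mul] at hc ⊢
    rw [hP, hP, hP, ← tsum_mul_left, ← tsum_mul_left,
      ← ((hS a ha).mul_left s).tsum_add ((hS b hb).mul_left t)]
    refine (hS _ hc).tsum_le_tsum ?_ (((hS a ha).mul_left s).add ((hS b hb).mul_left t))
    intro n
    have hd : 0 < s * ν^[n] a + t * ν^[n] b :=
      (convex_Ioi (0:ℝ)) (hit n a ha) (hit n b hb) hs ht hst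
    have h1 := fanti hd (hit n _ hc) (hconc n a b s t ha hb hs ht hst)
    have h2 := fconv.2 (hit n a ha) (hit n b hb) hs ht hst
    simp only [smul_eq_mul] at h2
    have h3 := mul_le_mul_of_nonneg_left (h1.trans h2) (hr n).le
    linarith
  have hy : ∀ m : ℕ, ∃ y : ℝ, 1 ≤ y ∧ P y = (M⁻¹)^m * P 1 := by
    intro m
    induction m with
    | zero => exact ⟨1, le_rfl, by simp⟩
    | succ m ih =>
      obtain ⟨y, hy1, hy2⟩ := ih
      have hyp : 0 < y := by linarith
      obtain ⟨z, hz, hzy⟩ := hν_surj hyp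
      have hz1 : 1 ≤ z := by have := hν_lt z hz; linarith
      refine ⟨z, hz1, ?_⟩
      rw [hrec z hz, fz z hz1, hzy, hy2, pow_succ]
      ring
  have hp1 := hPpos 1 one_pos
  have key : ConvexOn ℝ (Set.Ioi 0) (fun l => P l / P 1) := by
    have := hPconv.smul (c := (P 1)⁻¹) (by positivity)
    refine this.congr ?_
    intro l _
    simp only [smul_eq_mul]
    ring
  refine ⟨fun l => P l / P 1, key.continuousOn isOpen_Ioi, ?_, key, div_self hp1.ne',
    fun l hl => div_pos (hPpos l hl) hp1, ?_, ?_, ?_⟩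
  · intro a ha b hb hab
    exact div_lt_div_of_pos_right (hPanti ha hb hab) hp1
  · rw [Filter.tendsto_atTop]
    intro B
    obtain ⟨d, hd, hK⟩ := fK (B * P 1)
    filter_upwards [Ioo_mem_nhdsGT hd] with l hl
    rw [le_div_iff₀ hp1, hrec l hl.1]
    have := hK l hl.1 hl.2
    have h2 : 0 ≤ M⁻¹ * P (ν l) := mul_nonneg (by positivity) (hPnn _)
    linarith
  · rw [Metric.tendsto_atTop]
    intro e he
    obtain ⟨m, hm⟩ := exists_pow_lt_of_lt_one he (inv_lt_one_of_one_lt₀ hM)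
    obtain ⟨y, hy1, hy2⟩ := hy m
    refine ⟨y, fun l hl => ?_⟩
    have hlp : 0 < l := by linarith
    have h1 : P l ≤ P y := hPanti.antitoneOn (show y ∈ Set.Ioi (0:ℝ) by simp; linarith) hlp hl
    rw [Real.dist_eq, sub_zero, abs_of_pos (div_pos (hPpos l hlp) hp1), div_lt_iff₀ hp1]
    have := mul_lt_mul_of_pos_right hm hp1
    linarith
  · intro l hl
    rw [← mul_div_assoc]
    apply div_le_div_of_nonneg_right _ hp1.le
    rw [hrec l hl, mul_add, mul_inv_cancel_left₀ hM0.ne']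
    have := mul_nonneg hM0.le (f0 l)
    linarith
end

section
/- Let X be a set and let K : X × X → [0,∞] satisfy: (K1) K(x,y) = K(y,x) for all x,y ∈ X; (K2) K(x,y) > 0 for all x,y ∈ X; (K3) K(x,y) = +∞ if and only if x = y; (K4) there is a function ν : (0,∞) → (0,∞), continuous, concave, strictly increasing, surjective, with ν(λ) < λ for all λ > 0, such that for every λ > 0, if K(x,y) > λ and K(y,z) > λ then K(x,z) > ν(λ). Let ψ : (0,∞) → (0,∞) be a continuous strictly decreasing bijection of (0,∞) onto (0,∞) satisfying ψ(ν(λ)) ≤ 2·ψ(λ) for every λ > 0, and let η = ψ^{−1}. Then the family V(r) = {(x,y) ∈ X × X : K(x,y) > η(r)}, r > 0, satisfies: (S1) each V(r) is symmetric; (S2) the diagonal Δ ⊆ V(r) for all r > 0; (S3) V(r₁) ⊆ V(r₂) for 0 < r₁ ≤ r₂; (S4) ⋃_{r>0} V(r) = X × X; (S5) ⋂_{r>0} V(r) ⊆ Δ; and (S6) V(r) ∘ V(r) ⊆ V(2r) for every r > 0. -/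
/-- for a kernel `K` with (K1)–(K4) and a profile `ψ` (a continuous strictly
decreasing bijection of `(0,∞)` onto itself with `ψ(ν(λ)) ≤ 2ψ(λ)`) with inverse `η`, the
family `V(r) = {(x,y) : K(x,y) > η(r)}` satisfies (S1)–(S5) and (S6) with `T = 2`. -/
theorem superlevel_stripes_satisfy_S1_S6
    {X : Type*} (K : X → X → ENNReal)
    (hK1 : ∀ x y, K x y = K y x)
    (hK2 : ∀ x y, 0 < K x y)
    (hK3 : ∀ x y, K x y = ⊤ ↔ x = y)
    (ν : ℝ → ℝ)
    (hν_cont : ContinuousOn ν (Set.Ioi 0))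
    (hν_conc : ConcaveOn ℝ (Set.Ioi 0) ν)
    (hν_mono : StrictMonoOn ν (Set.Ioi 0))
    (hν_maps : Set.MapsTo ν (Set.Ioi 0) (Set.Ioi 0))
    (hν_surj : Set.SurjOn ν (Set.Ioi 0) (Set.Ioi 0))
    (hν_lt : ∀ l : ℝ, 0 < l → ν l < l)
    (hK4 : ∀ l : ℝ, 0 < l → ∀ x y z : X,
      ENNReal.ofReal l < K x y → ENNReal.ofReal l < K y z →
        ENNReal.ofReal (ν l) < K x z)
    (ψ : ℝ → ℝ)
    (hψ_cont : ContinuousOn ψ (Set.Ioi 0))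
    (hψ_anti : StrictAntiOn ψ (Set.Ioi 0))
    (hψ_bij : Set.BijOn ψ (Set.Ioi 0) (Set.Ioi 0))
    (hψν : ∀ l : ℝ, 0 < l → ψ (ν l) ≤ 2 * ψ l)
    (η : ℝ → ℝ)
    (hη_maps : Set.MapsTo η (Set.Ioi 0) (Set.Ioi 0))
    (hη_inv : Set.InvOn η ψ (Set.Ioi 0) (Set.Ioi 0))
    (V : ℝ → Set (X × X))
    (hV : ∀ r : ℝ, V r = {p : X × X | ENNReal.ofReal (η r) < K p.1 p.2}) :
    -- (S1)
    (∀ r : ℝ, 0 < r → ∀ x y : X, (x, y) ∈ V r ↔ (y, x) ∈ V r) ∧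
    -- (S2)
    (∀ r : ℝ, 0 < r → Set.diagonal X ⊆ V r) ∧
    -- (S3)
    (∀ r₁ r₂ : ℝ, 0 < r₁ → r₁ ≤ r₂ → V r₁ ⊆ V r₂) ∧
    -- (S4)
    (⋃ r ∈ Set.Ioi (0 : ℝ), V r) = Set.univ ∧
    -- (S5)
    (⋂ r ∈ Set.Ioi (0 : ℝ), V r) ⊆ Set.diagonal X ∧
    -- (S6) with T = 2
    (∀ r : ℝ, 0 < r → comp (V r) (V r) ⊆ V (2 * r)) := by
  have hinv1 : ∀ l : ℝ, 0 < l → η (ψ l) = l := fun l hl => hη_inv.1 hl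
  have hinv2 : ∀ r : ℝ, 0 < r → ψ (η r) = r := fun r hr => hη_inv.2 hr
  have hηpos : ∀ r : ℝ, 0 < r → 0 < η r := fun r hr => hη_maps hr
  have hψpos : ∀ l : ℝ, 0 < l → 0 < ψ l := fun l hl => hψ_bij.mapsTo hl
  -- if `ψ l ≤ r` then `η r ≤ l`
  have key : ∀ l r : ℝ, 0 < l → 0 < r → ψ l ≤ r → η r ≤ l := by
    intro l r hl hr h
    by_contra hc
    have h1 := hψ_anti (Set.mem_Ioi.2 hl) (Set.mem_Ioi.2 (hηpos r hr)) (not_le.1 hc)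
    rw [hinv2 r hr] at h1
    linarith
  have mem : ∀ (r : ℝ) (x y : X), (x, y) ∈ V r ↔ ENNReal.ofReal (η r) < K x y := by
    intro r x y
    rw [hV]
    rfl
  refine ⟨?_, ?_, ?_, ?_, ?_, ?_⟩
  · intro r _ x y
    rw [mem, mem, hK1]
  · rintro r _ ⟨x, y⟩ hxy
    rw [mem, (hK3 x y).2 hxy]
    exact ENNReal.ofReal_lt_top
  · rintro r₁ r₂ h1 h12 ⟨x, y⟩ hxy
    rw [mem] at hxy ⊢
    refine lt_of_le_of_lt (ENNReal.ofReal_le_ofReal ?_) hxy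
    exact key _ _ (hηpos _ h1) (h1.trans_le h12) (by rw [hinv2 _ h1]; exact h12)
  · rw [Set.eq_univ_iff_forall]
    rintro ⟨x, y⟩
    obtain ⟨q, hq0, hq⟩ := ENNReal.lt_iff_exists_nnreal_btwn.1 (hK2 x y)
    have hq0' : (0 : ℝ) < q := by exact_mod_cast hq0
    refine Set.mem_iUnion₂.2 ⟨ψ q, hψpos _ hq0', ?_⟩
    rw [mem, hinv1 _ hq0', ENNReal.ofReal_coe_nnreal]
    exact hq
  · rintro ⟨x, y⟩ h
    rw [Set.mem_iInter₂] at h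
    by_contra hne
    have hK : K x y ≠ ⊤ := fun e => hne ((hK3 x y).1 e)
    have hl : 0 < (K x y).toReal := ENNReal.toReal_pos (hK2 x y).ne' hK
    have h1 := h (ψ (K x y).toReal) (hψpos _ hl)
    rw [mem, hinv1 _ hl, ENNReal.ofReal_toReal hK] at h1
    exact lt_irrefl _ h1
  · rintro r hr ⟨x, z⟩ ⟨y, hxy, hyz⟩
    rw [mem] at hxy hyz ⊢
    refine lt_of_le_of_lt (ENNReal.ofReal_le_ofReal ?_) (hK4 _ (hηpos r hr) x y z hxy hyz)
    refine key _ _ (hν_maps (Set.mem_Ioi.2 (hηpos r hr))) (by linarith) ?_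
    have h2 := hψν _ (hηpos r hr)
    rwa [hinv2 r hr] at h2
end
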